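/- Define p : (0, 2π) → ℝ by 16 p(θ) = 6 A(θ) sin θ + (6 + 8 ln 2)(1 − cos θ) + 5(θ − π) sin θ + (5 cos θ − 4) ln(5 − 4 cos θ), where A(θ) = arctan(1/(3 tan(θ/2))) for θ ≠ π and A(π) sin π is interpreted as 0. Then ∫₀^{2π} p(θ) dθ = 0. -/

import Mathlib

open Real MeasureTheory
open scoped Real

/-- First-order shape correction `p` for two touching disks in the 2-D liquid drop
model (odd-branch `arccot` realized via `arctan` of the reciprocal). -/
noncomputable def pTouch (θ : ℝ) : ℝ :=
  (6 * Real.arctan (1/(3 * Real.tan (θ/2))) * Real.sin θ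
    + (6 + 8*Real.log 2) * (1 - Real.cos θ)
    + 5*(θ - π) * Real.sin θ
    + (5*Real.cos θ - 4) * Real.log (5 - 4*Real.cos θ)) / 16

/-- The smooth representative of the odd-branch `arccot (3 * tan (θ / 2))` on `(0, 2π)`. -/
noncomputable def smoothArccot (θ : ℝ) : ℝ :=
  (π - θ) / 2 - arctan (sin θ / (2 - cos θ))

theorem five_sub_four_cos_pos (θ : ℝ) : 0 < 5 - 4 * cos θ := by
  linarith [cos_le_one θ]

theorem hasDerivAt_smoothArccot (θ : ℝ) :
    HasDerivAt smoothArccot (-(3 / 2) / (5 - 4 * cos θ)) θ := by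
  have h2 : 2 - cos θ ≠ 0 := by linarith [cos_le_one θ]
  have h5 := (five_sub_four_cos_pos θ).ne'
  have hs : (2 - cos θ) ^ 2 + sin θ ^ 2 = 5 - 4 * cos θ := by
    linarith [sin_sq_add_cos_sq θ]
  have hden : 1 + (sin θ / (2 - cos θ)) ^ 2 = (5 - 4 * cos θ) / (2 - cos θ) ^ 2 := by
    rw [← hs]; field_simp
  have h := (((hasDerivAt_id θ).const_sub π).div_const 2).sub
    ((hasDerivAt_sin θ).div ((hasDerivAt_cos θ).const_sub 2) h2).arctan
  refine h.congr_deriv ?_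
  simp only [Pi.div_apply]
  rw [hden]
  field_simp
  linarith [sin_sq_add_cos_sq θ]

theorem arctan_tan_half_add {θ : ℝ} (hc : cos (θ / 2) ≠ 0) :
    arctan (tan (θ / 2)) + arctan (sin θ / (2 - cos θ)) = arctan (3 * tan (θ / 2)) := by
  have hsc := sin_sq_add_cos_sq (θ / 2)
  have hc2 : 0 < cos (θ / 2) ^ 2 := by positivity
  have hsin : sin θ = 2 * sin (θ / 2) * cos (θ / 2) := by
    rw [← sin_two_mul]; ring_nf
  have hcos : cos θ = 2 * cos (θ / 2) ^ 2 - 1 := by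
    rw [← cos_two_mul]; ring_nf
  have hx : sin θ / (2 - cos θ) = 2 * tan (θ / 2) / (1 + 3 * tan (θ / 2) ^ 2) := by
    have h2 : 2 - cos θ ≠ 0 := by linarith [cos_le_one θ]
    have h3 : 2 - cos θ = cos (θ / 2) ^ 2 + 3 * sin (θ / 2) ^ 2 := by linarith
    rw [h3] at h2 ⊢
    rw [hsin, tan_eq_sin_div_cos]
    field_simp
  set t := tan (θ / 2)
  have hpos : 0 < 1 + 3 * t ^ 2 := by positivity
  have htx : t * (2 * t / (1 + 3 * t ^ 2)) < 1 := by
    rw [← mul_div_assoc, div_lt_one hpos]; nlinarith [sq_nonneg t]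
  rw [hx, arctan_add htx]
  congr 1
  have : 1 - t * (2 * t / (1 + 3 * t ^ 2)) = (1 + t ^ 2) / (1 + 3 * t ^ 2) := by
    field_simp; ring
  rw [this]
  have : 1 + t ^ 2 ≠ 0 := by positivity
  field_simp
  ring

theorem arctan_inv_three_tan_half {θ : ℝ} (h0 : 0 < θ) (h1 : θ < 2 * π) :
    arctan (1 / (3 * tan (θ / 2))) = smoothArccot θ := by
  rw [smoothArccot, one_div]
  rcases lt_trichotomy θ π with h | rfl | h
  · have ht := tan_pos_of_pos_of_lt_pi_div_two (x := θ / 2) (by linarith) (by linarith)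
    have hadd := arctan_tan_half_add (θ := θ)
      (cos_pos_of_mem_Ioo ⟨by linarith, by linarith⟩).ne'
    rw [arctan_tan (by linarith) (by linarith)] at hadd
    rw [arctan_inv_of_pos (by positivity)]
    linarith
  · simp
  · have htan : tan (θ / 2) = tan (θ / 2 - π) := (tan_sub_pi _).symm
    have ht : tan (θ / 2) < 0 := by
      rw [htan]
      exact tan_neg_of_neg_of_pi_div_two_lt (by linarith) (by linarith)
    have hadd := arctan_tan_half_add (θ := θ)
      (cos_neg_of_pi_div_two_lt_of_lt (by linarith) (by linarith)).ne
    have harc : arctan (tan (θ / 2)) = θ / 2 - π := by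
      rw [htan, arctan_tan (by linarith) (by linarith)]
    rw [harc] at hadd
    rw [arctan_inv_of_neg (by linarith)]
    linarith

theorem integral_log_five_sub_four_cos :
    ∫ θ in (0 : ℝ)..(2 * π), log (5 - 4 * cos θ) = 4 * π * log 2 := by
  have hpt (θ : ℝ) : log (5 - 4 * cos θ) = 2 * log ‖circleMap 0 1 θ - 2‖ := by
    have hn : ‖circleMap 0 1 θ - 2‖ ^ 2 = 5 - 4 * cos θ := by
      rw [Complex.sq_norm, Complex.normSq_apply]
      simp [circleMap, Complex.exp_ofReal_mul_I_re, Complex.exp_ofReal_mul_I_im]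
      linarith [sin_sq_add_cos_sq θ]
    rw [← hn, log_pow]; norm_num
  have havg := circleAverage_log_norm_sub_const₂ (a := 2) (by norm_num)
  rw [circleAverage_def, smul_eq_mul, Complex.norm_ofNat] at havg
  simp_rw [hpt, intervalIntegral.integral_const_mul]
  have hpi := pi_pos.ne'
  field_simp at havg
  linarith

/-- A primitive of `16 * pTouch θ + 4 * log (5 - 4 * cos θ)` on `[0, 2π]`. -/
noncomputable def pTouchPrimitive (θ : ℝ) : ℝ :=
  -6 * (smoothArccot θ * cos θ) - 4 * θ + (6 + 8 * log 2) * (θ - sin θ)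
    - 5 * ((θ - π) * cos θ) + 5 * (sin θ * log (5 - 4 * cos θ))

theorem hasDerivAt_pTouchPrimitive (θ : ℝ) :
    HasDerivAt pTouchPrimitive
      (6 * smoothArccot θ * sin θ + (6 + 8 * log 2) * (1 - cos θ) + 5 * (θ - π) * sin θ
        + 5 * cos θ * log (5 - 4 * cos θ)) θ := by
  have h5 := (five_sub_four_cos_pos θ).ne'
  have hs := hasDerivAt_sin θ
  have hc := hasDerivAt_cos θ
  have hid := hasDerivAt_id' θ
  have h := ((((((hasDerivAt_smoothArccot θ).mul hc).const_mul (-6)).sub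
    (hid.const_mul 4)).add ((hid.sub hs).const_mul (6 + 8 * log 2))).sub
    (((hid.sub_const π).mul hc).const_mul 5)).add
    ((hs.mul (((hc.const_mul 4).const_sub 5).log h5)).const_mul 5)
  refine h.congr_deriv ?_
  field_simp
  linear_combination 40 * sin_sq_add_cos_sq θ

theorem pTouch_eq_smooth {θ : ℝ} (hθ : θ ∈ Set.Icc 0 (2 * π)) :
    pTouch θ =
      ((6 * smoothArccot θ * sin θ + (6 + 8 * log 2) * (1 - cos θ) + 5 * (θ - π) * sin θ
        + 5 * cos θ * log (5 - 4 * cos θ)) - 4 * log (5 - 4 * cos θ)) / 16 := by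
  have hA : arctan (1 / (3 * tan (θ / 2))) * sin θ = smoothArccot θ * sin θ := by
    rcases hθ.1.eq_or_lt with rfl | h0
    · simp
    rcases hθ.2.eq_or_lt with rfl | h1
    · simp
    rw [arctan_inv_three_tan_half h0 h1]
  rw [pTouch]
  linear_combination 6 / 16 * hA

/-- the area constraint on the perturbation: `∫₀^{2π} p(θ) dθ = 0`. -/
theorem pTouch_mean_zero : (∫ θ in (0:ℝ)..(2*π), pTouch θ) = 0 := by
  have hB : Continuous smoothArccot :=
    continuous_iff_continuousAt.2 fun θ => (hasDerivAt_smoothArccot θ).continuousAt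
  have hlog : Continuous fun θ : ℝ => log (5 - 4 * cos θ) :=
    Continuous.log (by fun_prop) fun θ => (five_sub_four_cos_pos θ).ne'
  have hF : Continuous fun θ : ℝ => 6 * smoothArccot θ * sin θ
      + (6 + 8 * log 2) * (1 - cos θ) + 5 * (θ - π) * sin θ
      + 5 * cos θ * log (5 - 4 * cos θ) := by fun_prop
  have hcongr := intervalIntegral.integral_congr (μ := volume) (a := 0) (b := 2 * π)
    fun θ hθ => pTouch_eq_smooth (Set.uIcc_of_le two_pi_pos.le ▸ hθ)
  rw [hcongr, intervalIntegral.integral_div,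
    intervalIntegral.integral_sub (hF.intervalIntegrable _ _)
      ((hlog.const_mul 4).intervalIntegrable _ _),
    intervalIntegral.integral_const_mul, integral_log_five_sub_four_cos,
    intervalIntegral.integral_eq_sub_of_hasDerivAt
      (fun θ _ => hasDerivAt_pTouchPrimitive θ) (hF.intervalIntegrable _ _)]
  simp [pTouchPrimitive, smoothArccot]
  ring
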